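/- Let 2 < p ≤ ∞, let D be an open subset of ℂⁿ, let u ∈ L¹_loc(D), and suppose ∂̄u = v₁ dz̄₁ + … + v_n dz̄_n in the distribution sense. Assume that for each j = 1,…,n there is a constant M such that ‖v_j‖_{L^p(D ∩ L_{j,ε})} ≤ M (πε²)^{(n−1)/p} for all complex lines L_j parallel to the z_j-axis and all ε > 0, where L_{j,ε} is the sup-norm ε-neighborhood of L_j in ℂⁿ. Then u is locally of class C^α on D, with α = 1 − 2/p when 2 < p < ∞, and with any α < 1 when p = ∞. -/

import Mathlib

open MeasureTheory Metric Set

noncomputable section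

/-- The Wirtinger derivative `∂φ/∂z̄_j` of a function `φ : ℂⁿ → ℂ`. -/
def dbarCoord (n : ℕ) (φ : (Fin n → ℂ) → ℂ) (j : Fin n) (z : Fin n → ℂ) : ℂ :=
  (1 / 2 : ℂ) *
    (fderiv ℝ φ z (Pi.single j 1) + Complex.I * fderiv ℝ φ z (Pi.single j Complex.I))

/-- A test function on `U ⊆ ℂⁿ`. -/
def IsTestC (n : ℕ) (U : Set (Fin n → ℂ)) (φ : (Fin n → ℂ) → ℂ) : Prop :=
  ContDiff ℝ (⊤ : ℕ∞) φ ∧ HasCompactSupport φ ∧ tsupport φ ⊆ U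

/-- The sup-norm `ε`-neighborhood of the complex line through `c` parallel to the
`z_j`-axis. -/
def lineNbhd (n : ℕ) (j : Fin n) (c : Fin n → ℂ) (ε : ℝ) : Set (Fin n → ℂ) :=
  {z | ∀ i : Fin n, i ≠ j → dist (z i) (c i) < ε}

/-- `u` is locally Hölder of exponent `α` on `U`. -/
def HolderLocOnC (n : ℕ) (α : ℝ) (u : (Fin n → ℂ) → ℂ) (U : Set (Fin n → ℂ)) : Prop :=
  ∀ x ∈ U, ∃ t : Set (Fin n → ℂ), IsOpen t ∧ x ∈ t ∧
    ∃ C : ℝ, ∀ a ∈ t ∩ U, ∀ b ∈ t ∩ U, ‖u a - u b‖ ≤ C * dist a b ^ α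


open scoped ContDiff

def chiK (s : ℝ) : ℝ := Real.smoothTransition (2 * s - 1)

def GK (n : ℕ) (s : ℝ) : ℝ := chiK s / s ^ n

def SK (n : ℕ) (z : Fin n → ℂ) : ℝ := ∑ i, ((z i).re ^ 2 + (z i).im ^ 2)

def QK (n : ℕ) (j : Fin n) (z : Fin n → ℂ) : ℂ := (starRingEnd ℂ) (z j) * (GK n (SK n z) : ℂ)

lemma chiK_contDiff : ContDiff ℝ ∞ chiK := by
  unfold chiK
  exact Real.smoothTransition.contDiff.comp (by fun_prop)

lemma chiK_zero {s : ℝ} (h : s ≤ 1/2) : chiK s = 0 :=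
  Real.smoothTransition.zero_of_nonpos (by linarith)

lemma chiK_one {s : ℝ} (h : 1 ≤ s) : chiK s = 1 :=
  Real.smoothTransition.one_of_one_le (by linarith)

lemma chiK_mono : Monotone chiK := by
  intro a b hab
  unfold chiK
  exact Real.smoothTransition.monotone (by linarith)

lemma GK_contDiff (n : ℕ) : ContDiff ℝ ∞ (GK n) := by
  rw [contDiff_iff_contDiffAt]
  intro s
  by_cases hs : s < 1/2
  · have : GK n =ᶠ[nhds s] fun _ => 0 := by
      filter_upwards [Iio_mem_nhds hs] with t ht
      simp [GK, chiK_zero (le_of_lt ht)]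
    exact contDiffAt_const.congr_of_eventuallyEq this
  · have hs0 : s ≠ 0 := by intro h; apply hs; rw [h]; norm_num
    exact chiK_contDiff.contDiffAt.div (contDiffAt_id.pow n) (pow_ne_zero _ hs0)

lemma SK_contDiff (n : ℕ) : ContDiff ℝ ∞ (SK n) := by
  unfold SK
  apply ContDiff.sum
  intro i _
  have h1 : ContDiff ℝ ∞ (fun z : Fin n → ℂ => (z i).re) :=
    Complex.reCLM.contDiff.comp (contDiff_apply ℝ ℂ i)
  have h2 : ContDiff ℝ ∞ (fun z : Fin n → ℂ => (z i).im) :=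
    Complex.imCLM.contDiff.comp (contDiff_apply ℝ ℂ i)
  exact (h1.pow 2).add (h2.pow 2)

lemma QK_contDiff (n : ℕ) (j : Fin n) : ContDiff ℝ ∞ (QK n j) := by
  unfold QK
  have h1 : ContDiff ℝ ∞ (fun z : Fin n → ℂ => (starRingEnd ℂ) (z j)) :=
    Complex.conjCLE.contDiff.comp (contDiff_apply ℝ ℂ j)
  have h2 : ContDiff ℝ ∞ (fun z : Fin n → ℂ => (GK n (SK n z) : ℂ)) :=
    Complex.ofRealCLM.contDiff.comp ((GK_contDiff n).comp (SK_contDiff n))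
  exact h1.mul h2

lemma SK_hasDerivAt_single (n : ℕ) (z : Fin n → ℂ) (j : Fin n) (w : ℂ) :
    HasDerivAt (fun t : ℝ => SK n (z + t • (Pi.single j w : Fin n → ℂ)))
      (2 * ((z j).re * w.re + (z j).im * w.im)) 0 := by
  unfold SK
  have : ∀ i, HasDerivAt (fun t : ℝ => (((z + t • (Pi.single j w : Fin n → ℂ)) : Fin n → ℂ) i).re ^ 2 +
      (((z + t • (Pi.single j w : Fin n → ℂ)) : Fin n → ℂ) i).im ^ 2)
      (if i = j then 2 * ((z j).re * w.re + (z j).im * w.im) else 0) 0 := by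
    intro i
    by_cases h : i = j
    · subst h
      simp only [Pi.add_apply, Pi.smul_apply, Pi.single_eq_same, Complex.add_re, Complex.add_im,
        Complex.real_smul, Complex.mul_re, Complex.mul_im, Complex.ofReal_re, Complex.ofReal_im,
        zero_mul, sub_zero, add_zero, if_true]
      have a1 : HasDerivAt (fun t : ℝ => (z i).re + t * w.re) w.re 0 := by
        simpa using ((hasDerivAt_id (0:ℝ)).mul_const w.re).const_add (z i).re
      have a2 : HasDerivAt (fun t : ℝ => (z i).im + t * w.im) w.im 0 := by
        simpa using ((hasDerivAt_id (0:ℝ)).mul_const w.im).const_add (z i).im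
      refine ((a1.fun_pow 2).fun_add (a2.fun_pow 2)).congr_deriv ?_
      simp; ring
    · simp [h, hasDerivAt_const]
  refine (HasDerivAt.fun_sum (fun i (_ : i ∈ Finset.univ) => this i)).congr_deriv ?_
  simp

lemma fderiv_of_line {n : ℕ} {φ : (Fin n → ℂ) → ℂ} (h : ContDiff ℝ ∞ φ) (z v : Fin n → ℂ) {d : ℂ}
    (hd : HasDerivAt (fun t : ℝ => φ (z + t • v)) d 0) : fderiv ℝ φ z v = d := by
  have h1 : DifferentiableAt ℝ φ z := (h.differentiable (by simp)) z
  rw [← h1.lineDeriv_eq_fderiv]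
  exact hd.deriv

lemma QK_hasDerivAt (n : ℕ) (j : Fin n) (z : Fin n → ℂ) (w : ℂ) :
    HasDerivAt (fun t : ℝ => QK n j (z + t • (Pi.single j w : Fin n → ℂ)))
      ((starRingEnd ℂ) w * (GK n (SK n z) : ℂ) + (starRingEnd ℂ) (z j) *
        ((deriv (GK n) (SK n z) * (2 * ((z j).re * w.re + (z j).im * w.im)) : ℝ) : ℂ)) 0 := by
  unfold QK
  have h1 : HasDerivAt (fun t : ℝ => (starRingEnd ℂ) ((z + t • (Pi.single j w : Fin n → ℂ) : Fin n → ℂ) j))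
      ((starRingEnd ℂ) w) 0 := by
    simp only [Pi.add_apply, Pi.smul_apply, Pi.single_eq_same, Complex.real_smul, map_add, map_mul,
      Complex.conj_ofReal]
    simpa using ((Complex.ofRealCLM.hasDerivAt (x := (0:ℝ))).mul_const
      ((starRingEnd ℂ) w)).const_add ((starRingEnd ℂ) (z j))
  have h2 : HasDerivAt (fun t : ℝ => GK n (SK n (z + t • (Pi.single j w : Fin n → ℂ))))
      (deriv (GK n) (SK n z) * (2 * ((z j).re * w.re + (z j).im * w.im))) 0 := by
    have hG : HasDerivAt (GK n) (deriv (GK n) (SK n z)) (SK n (z + (0:ℝ) • (Pi.single j w : Fin n → ℂ))) := by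
      have := ((GK_contDiff n).differentiable (by simp) (SK n z)).hasDerivAt
      simpa using this
    exact hG.comp (0:ℝ) (SK_hasDerivAt_single n z j w)
  have h3 := h1.fun_mul h2.ofReal_comp
  refine h3.congr_deriv ?_
  simp

lemma dbar_QK (n : ℕ) (j : Fin n) (z : Fin n → ℂ) :
    dbarCoord n (QK n j) j z =
      ((GK n (SK n z) + ((z j).re ^ 2 + (z j).im ^ 2) * deriv (GK n) (SK n z) : ℝ) : ℂ) := by
  unfold dbarCoord
  rw [fderiv_of_line (QK_contDiff n j) z _ (QK_hasDerivAt n j z 1),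
    fderiv_of_line (QK_contDiff n j) z _ (QK_hasDerivAt n j z Complex.I)]
  apply Complex.ext <;> simp [-Complex.ofReal_pow] <;> ring

def rK (n : ℕ) (s : ℝ) : ℝ := n * GK n s + s * deriv (GK n) s

lemma sum_dbar_QK (n : ℕ) (z : Fin n → ℂ) :
    ∑ j, dbarCoord n (QK n j) j z = (rK n (SK n z) : ℂ) := by
  simp only [dbar_QK]
  rw [← Complex.ofReal_sum, Finset.sum_add_distrib, ← Finset.sum_mul]
  simp [rK, SK]

lemma rK_eq {n : ℕ} (hn : n ≠ 0) {s : ℝ} (hs : 0 < s) : s ^ (n-1) * rK n s = deriv chiK s := by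
  have h1 : HasDerivAt (fun s => s ^ n * GK n s)
     (n * s ^ (n-1) * GK n s + s ^ n * deriv (GK n) s) s := by
    have hG := ((GK_contDiff n).differentiable (by simp) s).hasDerivAt
    exact (hasDerivAt_pow n s).mul hG
  have h2 : (fun s => s ^ n * GK n s) =ᶠ[nhds s] chiK := by
    filter_upwards [Ioi_mem_nhds hs] with t ht
    have : t ≠ 0 := ne_of_gt ht
    simp only [GK]; field_simp
  rw [← h2.deriv_eq, h1.deriv, rK]
  obtain ⟨m, rfl⟩ := Nat.exists_eq_succ_of_ne_zero hn
  simp [pow_succ]; ring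

lemma rK_nonneg {n : ℕ} (hn : n ≠ 0) {s : ℝ} (hs : 0 ≤ s) : 0 ≤ rK n s := by
  rcases hs.eq_or_lt with rfl | h
  · simp [rK, GK, hn]
  · have h1 := rK_eq hn h
    have h2 : 0 ≤ deriv chiK s := chiK_mono.deriv_nonneg
    rw [← h1] at h2
    exact nonneg_of_mul_nonneg_right h2 (by positivity)

lemma rK_zero {n : ℕ} (hn : n ≠ 0) {s : ℝ} (hs : 1 < s) : rK n s = 0 := by
  have h1 := rK_eq hn (zero_lt_one.trans hs)
  have h2 : deriv chiK s = 0 := by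
    have : chiK =ᶠ[nhds s] fun _ => 1 := by
      filter_upwards [Ioi_mem_nhds hs] with t ht
      exact chiK_one (le_of_lt ht)
    rw [this.deriv_eq]; simp
  rw [h2] at h1
  rcases mul_eq_zero.1 h1 with h | h
  · exact absurd h (by positivity)
  · exact h

lemma rK_pos {n : ℕ} (hn : n ≠ 0) : ∃ s, 0 < s ∧ rK n s ≠ 0 := by
  obtain ⟨s, hs, h⟩ := exists_deriv_eq_slope chiK (zero_lt_one) chiK_contDiff.continuous.continuousOn
    (chiK_contDiff.differentiable (by simp)).differentiableOn
  refine ⟨s, hs.1, fun h0 => ?_⟩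
  rw [← rK_eq hn hs.1, h0, chiK_one le_rfl, chiK_zero (by norm_num)] at h
  norm_num at h

lemma rK_contDiff (n : ℕ) : ContDiff ℝ ∞ (rK n) := by
  unfold rK
  have : ContDiff ℝ ∞ (deriv (GK n)) := ((contDiff_infty_iff_deriv).1 (GK_contDiff n)).2
  have := GK_contDiff n
  fun_prop

lemma SK_gt {n : ℕ} {z : Fin n → ℂ} (h : 1 < ‖z‖) : 1 < SK n z := by
  by_contra hc
  push Not at hc
  apply absurd h
  push Not
  rw [pi_norm_le_iff_of_nonneg zero_le_one]
  intro i
  have h1 : (z i).re ^ 2 + (z i).im ^ 2 ≤ SK n z :=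
    Finset.single_le_sum (f := fun i => (z i).re ^ 2 + (z i).im ^ 2)
      (fun i _ => by positivity) (Finset.mem_univ i)
  have h2 : ‖z i‖ ^ 2 = (z i).re ^ 2 + (z i).im ^ 2 := by
    rw [← Complex.normSq_eq_norm_sq, Complex.normSq_apply]; ring
  nlinarith [norm_nonneg (z i)]

lemma SK_nonneg {n : ℕ} (z : Fin n → ℂ) : 0 ≤ SK n z :=
  Finset.sum_nonneg fun i _ => by positivity

lemma hasCompactSupport_of_ball {n : ℕ} {β : Type*} [Zero β] {f : (Fin n → ℂ) → β} 
    (h : ∀ z, 1 < ‖z‖ → f z = 0) : HasCompactSupport f := by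
  apply HasCompactSupport.of_support_subset_isCompact (isCompact_closedBall (0 : Fin n → ℂ) 1)
  intro z hz
  rw [mem_closedBall_zero_iff]
  by_contra hc
  exact hz (h z (not_le.1 hc))

lemma dbar_scale {n : ℕ} {φ : (Fin n → ℂ) → ℂ} (h : ContDiff ℝ ∞ φ) (c : ℂ) (l : ℝ)
    (x : Fin n → ℂ) (j : Fin n) (z : Fin n → ℂ) :
    dbarCoord n (fun z => c * φ (l • (z - x))) j z = c * l * dbarCoord n φ j (l • (z - x)) := by
  have h1 : HasFDerivAt (fun z => c * φ (l • (z - x)))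
      (c • ((fderiv ℝ φ (l • (z - x))).comp (l • ContinuousLinearMap.id ℝ (Fin n → ℂ)))) z := by
    have a : HasFDerivAt (fun z : Fin n → ℂ => l • (z - x))
        (l • ContinuousLinearMap.id ℝ (Fin n → ℂ)) z :=
      ((hasFDerivAt_id z).sub_const x).const_smul l
    have b := (h.differentiable (by simp) (l • (z - x))).hasFDerivAt
    exact (b.comp z a).const_mul c
  unfold dbarCoord
  rw [h1.fderiv]
  simp
  ring

lemma dbar_lin {n : ℕ} {φ ψ : (Fin n → ℂ) → ℂ} (h : ContDiff ℝ ∞ φ) (h' : ContDiff ℝ ∞ ψ)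
    (j : Fin n) (z : Fin n → ℂ) :
    dbarCoord n (fun z => φ z + ψ z) j z = dbarCoord n φ j z + dbarCoord n ψ j z := by
  have a := (h.differentiable (by simp) z)
  have b := (h'.differentiable (by simp) z)
  unfold dbarCoord
  rw [fderiv_fun_add a b]
  simp
  ring

lemma exists_kernel {n : ℕ} (hn : n ≠ 0) : ∃ (ρ : (Fin n → ℂ) → ℂ) (Ψ : Fin n → (Fin n → ℂ) → ℂ),
    ContDiff ℝ ∞ ρ ∧ (∀ j, ContDiff ℝ ∞ (Ψ j)) ∧ (∀ z, 1 < ‖z‖ → ρ z = 0) ∧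
    (∀ j z, 1 < ‖z‖ → Ψ j z = 0) ∧ ∫ z, ρ z = 1 ∧
    ∀ z, 2 ^ (2 * n) * ρ ((2:ℝ) • z) - ρ z = ∑ j, dbarCoord n (Ψ j) j z := by
  set f : (Fin n → ℂ) → ℝ := fun z => rK n (SK n z) with hf
  have fsm : ContDiff ℝ ∞ f := (rK_contDiff n).comp (SK_contDiff n)
  have fz : ∀ z, 1 < ‖z‖ → f z = 0 := fun z hz => rK_zero hn (SK_gt hz)
  have fpos : 0 < ∫ z, f z := by
    obtain ⟨s, hs, h⟩ := rK_pos hn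
    obtain ⟨m, rfl⟩ := Nat.exists_eq_succ_of_ne_zero hn
    apply fsm.continuous.integral_pos_of_hasCompactSupport_nonneg_nonzero
      (hasCompactSupport_of_ball fz) (fun z => rK_nonneg hn (SK_nonneg z))
      (x := Pi.single 0 ((Real.sqrt s : ℝ) : ℂ))
    have : SK (m+1) (Pi.single 0 ((Real.sqrt s : ℝ) : ℂ)) = s := by
      unfold SK
      rw [Finset.sum_eq_single 0]
      · simp [Real.sq_sqrt hs.le]
      · intro i _ hi; simp [hi]
      · simp
    simp only [hf]
    rw [show SK m.succ (Pi.single 0 ((Real.sqrt s : ℝ) : ℂ)) = s from this]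
    exact h
  set c : ℝ := ∫ z, f z
  have hc : (c : ℂ) ≠ 0 := by exact_mod_cast fpos.ne'
  have Qs : ∀ (j : Fin n) (a : ℂ) (l : ℝ), ContDiff ℝ ∞ (fun z => a * QK n j (l • (z - 0))) := by
    intro j a l
    exact contDiff_const.mul ((QK_contDiff n j).comp (by fun_prop))
  refine ⟨fun z => (c:ℂ)⁻¹ * f z, fun j z => ((c:ℂ)⁻¹ * (2 ^ (2*n) / 2)) * QK n j ((2:ℝ) • (z - 0)) +
    (-(c:ℂ)⁻¹) * QK n j ((1:ℝ) • (z - 0)), ?_, ?_, ?_, ?_, ?_, ?_⟩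
  · exact contDiff_const.mul (Complex.ofRealCLM.contDiff.comp fsm)
  · intro j
    exact (Qs j _ _).add (Qs j _ _)
  · intro z hz; simp [fz z hz]
  · intro j z hz
    have h1 := SK_gt hz
    have h2 : SK n ((2:ℝ) • z) = 4 * SK n z := by
      simp only [SK, Finset.mul_sum]
      congr 1; ext i; simp; ring
    simp only [QK, sub_zero, one_smul, h2, GK, chiK_one h1.le, chiK_one (s := 4 * SK n z) (by linarith)]
    have h3 : (SK n z : ℂ) ≠ 0 := by
      have : SK n z ≠ 0 := by positivity
      exact_mod_cast this
    simp
    rw [pow_mul, mul_pow]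
    field_simp
    norm_num
    right; rw [map_ofNat]; ring
  · rw [integral_const_mul, integral_complex_ofReal]
    exact inv_mul_cancel₀ hc
  · intro z
    simp only [dbar_lin (Qs _ _ _) (Qs _ _ _), dbar_scale (QK_contDiff n _)]
    rw [Finset.sum_add_distrib, ← Finset.mul_sum, ← Finset.mul_sum, sum_dbar_QK, sum_dbar_QK]
    simp [hf]
    ring

lemma seq_holder {α A B L d : ℝ} (h0 : 0 < α) (h1 : α < 1) (hA : 0 ≤ A) (hB : 0 ≤ B) (hL : 0 ≤ L)
    (hd : 0 < d) (hd1 : d ≤ 1) {q : ℝ} (hq : q = (2:ℝ) ^ (-α)) {a b : ℕ → ℂ} {a' b' : ℂ}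
    (ha : ∀ k, ‖a (k+1) - a k‖ ≤ A * q ^ k) (hb : ∀ k, ‖b (k+1) - b k‖ ≤ A * q ^ k)
    (hab : ∀ k, 2 ^ k * d ≤ 1 → ‖(a (k+1) - a k) - (b (k+1) - b k)‖ ≤ B * (2 * q) ^ k * d)
    (hab0 : ‖a 0 - b 0‖ ≤ L * d)
    (hta : Filter.Tendsto a Filter.atTop (nhds a')) (htb : Filter.Tendsto b Filter.atTop (nhds b')) :
    ‖a' - b'‖ ≤ (L + 2 * B / (2 * q - 1) + 4 * A / (1 - q)) * d ^ α := by
  have hq0 : 0 < q := by rw [hq]; positivity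
  have hq1 : q < 1 := by
    rw [hq]; exact Real.rpow_lt_one_of_one_lt_of_neg (by norm_num) (by linarith)
  have hq2 : 1 < 2 * q := by
    have : (2:ℝ) * q = 2 ^ (1 - α) := by
      rw [hq, sub_eq_add_neg, Real.rpow_add (by norm_num), Real.rpow_one]
    rw [this]; exact Real.one_lt_rpow (by norm_num) (by linarith)
  obtain ⟨N, hN1, hN2⟩ := exists_nat_pow_near (one_le_one_div hd hd1) (one_lt_two)
  have hN1' : 2 ^ N * d ≤ 1 := by rwa [le_div_iff₀ hd] at hN1
  have hN2' : 1 < 2 ^ (N+1) * d := by rwa [div_lt_iff₀ hd] at hN2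
  have hqN : q ^ N ≤ 2 * d ^ α := by
    have e1 : q ^ N = ((2:ℝ) ^ N) ^ (-α) := by
      rw [hq, ← Real.rpow_natCast, ← Real.rpow_natCast, ← Real.rpow_mul (by norm_num),
        ← Real.rpow_mul (by norm_num), mul_comm]
    have e2 : ((2:ℝ) ^ N) ^ (-α) ≤ ((2 * d)⁻¹) ^ (-α) := by
      apply Real.rpow_le_rpow_of_nonpos (by positivity) _ (by linarith)
      rw [inv_le_iff_one_le_mul₀ (by positivity)]
      rw [pow_succ] at hN2'
      linarith
    have e3 : ((2 * d)⁻¹) ^ (-α) = (2:ℝ) ^ α * d ^ α := by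
      rw [Real.inv_rpow (by positivity), Real.rpow_neg (by positivity), inv_inv,
        Real.mul_rpow (by norm_num) hd.le]
    have e4 : (2:ℝ) ^ α ≤ 2 := by
      calc (2:ℝ) ^ α ≤ 2 ^ (1:ℝ) := Real.rpow_le_rpow_of_exponent_le (by norm_num) h1.le
        _ = 2 := by simp
    rw [e1]
    refine e2.trans ?_
    rw [e3]
    gcongr
  have hdα : d ≤ d ^ α := by
    calc d = d ^ (1:ℝ) := by simp
      _ ≤ d ^ α := Real.rpow_le_rpow_of_exponent_ge hd hd1 h1.le
  have head : ∀ m, m ≤ N → ‖a m - b m‖ ≤ L * d + B * d * ((2 * q) ^ m / (2 * q - 1)) := by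
    intro m
    induction m with
    | zero =>
      intro _
      have : 0 ≤ B * d * ((2 * q) ^ 0 / (2 * q - 1)) := by
        have : 0 < 2 * q - 1 := by linarith
        positivity
      linarith
    | succ m ih =>
      intro hm
      have i1 := ih (by omega)
      have i2 := hab m (by
        refine le_trans ?_ hN1'
        gcongr
        · norm_num
        · omega)
      have i3 : a (m+1) - b (m+1) = (a m - b m) + ((a (m+1) - a m) - (b (m+1) - b m)) := by ring
      rw [i3]
      refine (norm_add_le _ _).trans ((add_le_add i1 i2).trans (le_of_eq ?_))
      have : 2 * q - 1 ≠ 0 := by linarith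
      field_simp
      ring
  have t1 := dist_le_of_le_geometric_of_tendsto q A hq1 (f := a)
    (fun k => by rw [dist_comm, dist_eq_norm]; exact ha k) hta N
  have t2 := dist_le_of_le_geometric_of_tendsto q A hq1 (f := b)
    (fun k => by rw [dist_comm, dist_eq_norm]; exact hb k) htb N
  have t3 := head N le_rfl
  have p1 : 0 < 2 * q - 1 := by linarith
  have p2 : 0 < 1 - q := by linarith
  have t4 : A * q ^ N / (1 - q) ≤ 2 * A / (1 - q) * d ^ α := by
    calc A * q ^ N / (1 - q) ≤ A * (2 * d ^ α) / (1 - q) := by gcongr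
      _ = _ := by ring
  have t5 : B * d * ((2 * q) ^ N / (2 * q - 1)) ≤ 2 * B / (2 * q - 1) * d ^ α := by
    calc B * d * ((2 * q) ^ N / (2 * q - 1)) = B * ((2 ^ N * d) * q ^ N) / (2 * q - 1) := by
          rw [mul_pow]; ring
      _ ≤ B * (1 * (2 * d ^ α)) / (2 * q - 1) := by gcongr
      _ = _ := by ring
  have t6 : L * d ≤ L * d ^ α := by gcongr
  have e : a' - b' = (a N - b N) - (a N - a') + (b N - b') := by ring
  rw [dist_eq_norm] at t1 t2
  calc ‖a' - b'‖ ≤ ‖a N - b N‖ + ‖a N - a'‖ + ‖b N - b'‖ := by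
        rw [e]
        refine (norm_add_le _ _).trans ?_
        gcongr
        exact norm_sub_le _ _
    _ ≤ (L * d + B * d * ((2 * q) ^ N / (2 * q - 1))) + A * q ^ N / (1 - q) + A * q ^ N / (1 - q) := by
        gcongr
    _ ≤ _ := by
        have : (L + 2 * B / (2 * q - 1) + 4 * A / (1 - q)) * d ^ α =
          L * d ^ α + 2 * B / (2 * q - 1) * d ^ α + 2 * A / (1 - q) * d ^ α +
          2 * A / (1 - q) * d ^ α := by ring
        rw [this]
        linarith

lemma dbar_continuous {n : ℕ} {φ : (Fin n → ℂ) → ℂ} (h : ContDiff ℝ ∞ φ) (j : Fin n) :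
    Continuous (dbarCoord n φ j) := by
  unfold dbarCoord
  have := h.continuous_fderiv (by simp)
  fun_prop

lemma dbar_zero {n : ℕ} {φ : (Fin n → ℂ) → ℂ} (j : Fin n) {z : Fin n → ℂ} (hz : z ∉ tsupport φ) :
    dbarCoord n φ j z = 0 := by
  unfold dbarCoord
  have : fderiv ℝ φ z = 0 := by
    have h := notMem_tsupport_iff_eventuallyEq.1 hz
    rw [h.fderiv_eq]; simp
  simp [this]

lemma integrableOn_mul {n : ℕ} {D : Set (Fin n → ℂ)} (hD : IsOpen D) {u g : (Fin n → ℂ) → ℂ}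
    (hu : LocallyIntegrableOn u D) (hg : Continuous g) {K : Set (Fin n → ℂ)} (hK : IsCompact K)
    (hKD : K ⊆ D) (h0 : ∀ z, z ∉ K → g z = 0) : IntegrableOn (fun z => u z * g z) D := by
  have h1 : IntegrableOn u K := hu.integrableOn_compact_subset hKD hK
  have h2 : IntegrableOn (fun z => u z * g z) K := h1.mul_continuousOn hg.continuousOn hK
  have h3 : Integrable (fun z => u z * g z) := by
    rw [← integrableOn_iff_integrable_of_support_subset (s := K)]
    · exact h2
    · intro z hz
      by_contra hc
      exact hz (by simp [h0 z hc])
  exact h3.integrableOn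

lemma integrableOn_dbar {n : ℕ} {D : Set (Fin n → ℂ)} (hD : IsOpen D) {u φ : (Fin n → ℂ) → ℂ}
    (hu : LocallyIntegrableOn u D) (hφ : IsTestC n D φ) (j : Fin n) :
    IntegrableOn (fun z => u z * dbarCoord n φ j z) D :=
  integrableOn_mul hD hu (dbar_continuous hφ.1 j) hφ.2.1 hφ.2.2 (fun z hz => dbar_zero j hz)

lemma IsTestC.add {n : ℕ} {D : Set (Fin n → ℂ)} {φ ψ : (Fin n → ℂ) → ℂ} (h : IsTestC n D φ)
    (h' : IsTestC n D ψ) : IsTestC n D (fun z => φ z + ψ z) :=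
  ⟨h.1.add h'.1, h.2.1.add h'.2.1, (tsupport_add φ ψ).trans (union_subset h.2.2 h'.2.2)⟩

/-- Either `v` is locally integrable or the distribution vanishes. -/
lemma exists_w {n : ℕ} {D : Set (Fin n → ℂ)} (hD : IsOpen D) {u : (Fin n → ℂ) → ℂ}
    (hu : LocallyIntegrableOn u D) (v : (Fin n → ℂ) → ℂ) (j : Fin n)
    (heq : ∀ φ : (Fin n → ℂ) → ℂ, IsTestC n D φ →
      ∫ z in D, u z * dbarCoord n φ j z = - ∫ z in D, v z * φ z) :
    ∃ w : (Fin n → ℂ) → ℂ, LocallyIntegrableOn w D ∧ (w = v ∨ w = fun _ => 0) ∧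
      ∀ φ : (Fin n → ℂ) → ℂ, IsTestC n D φ →
      ∫ z in D, u z * dbarCoord n φ j z = - ∫ z in D, w z * φ z := by
  by_cases hv : LocallyIntegrableOn v D
  · exact ⟨v, hv, Or.inl rfl, heq⟩
  refine ⟨fun _ => 0, (locallyIntegrable_zero).locallyIntegrableOn D, Or.inr rfl, ?_⟩
  simp only [LocallyIntegrableOn] at hv
  push Not at hv
  obtain ⟨x, hx, hvx⟩ := hv
  have key : ∀ φ : (Fin n → ℂ) → ℂ, IsTestC n D φ → φ x ≠ 0 →
      ∫ z in D, u z * dbarCoord n φ j z = 0 := by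
    intro φ hφ hφx
    rw [heq φ hφ]
    suffices ¬ IntegrableOn (fun z => v z * φ z) D by
      rw [integral_undef this, neg_zero]
    intro hi
    apply hvx
    obtain ⟨r, hr, hrx⟩ := Metric.nhds_basis_closedBall.mem_iff.1
      ((hφ.1.continuous.continuousAt.eventually_ne hφx).and (hD.mem_nhds hx))
    have hc : ContinuousOn (fun z => (φ z)⁻¹) (closedBall x r) :=
      hφ.1.continuous.continuousOn.inv₀ (fun z hz => (hrx hz).1)
    have i1 : IntegrableOn (fun z => v z * φ z) (closedBall x r) :=
      hi.mono_set (fun z hz => (hrx hz).2)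
    have i2 := i1.mul_continuousOn hc (isCompact_closedBall x r)
    refine ⟨closedBall x r, mem_nhdsWithin_of_mem_nhds (closedBall_mem_nhds x hr), ?_⟩
    refine i2.congr_fun (fun z hz => ?_) measurableSet_closedBall
    have := (hrx hz).1
    field_simp
  intro φ hφ
  simp only [zero_mul, integral_zero, neg_zero]
  by_cases h0 : φ x = 0
  · obtain ⟨ψ, h1, h2, h3, -, h5⟩ := exists_contDiff_tsupport_subset (n := ⊤) (hD.mem_nhds hx)
    have hψ : IsTestC n D (fun z => (ψ z : ℂ)) := by
      refine ⟨Complex.ofRealCLM.contDiff.comp h3, h2.comp_left (g := fun r : ℝ => (r:ℂ)) (by simp), ?_⟩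
      exact (closure_mono (Function.support_comp_subset (g := fun r : ℝ => (r:ℂ)) (by simp) ψ)).trans h1
    have e1 := key _ hψ (by simp [h5])
    have e2 := key _ (hφ.add hψ) (by simp [h5, h0])
    simp only [dbar_lin hφ.1 hψ.1, mul_add] at e2
    rw [integral_add (integrableOn_dbar hD hu hφ j) (integrableOn_dbar hD hu hψ j), e1, add_zero] at e2
    exact e2
  · exact key φ hφ h0

lemma vol_ball_pi {n : ℕ} (x : Fin n → ℂ) {r : ℝ} (hr : 0 < r) :
    volume (ball x r) = ENNReal.ofReal ((Real.pi * r ^ 2) ^ n) := by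
  rw [volume_pi_ball _ hr]
  simp only [Complex.volume_ball, Finset.prod_const, Finset.card_univ, Fintype.card_fin]
  rw [ENNReal.ofReal_pow (by positivity), mul_comm Real.pi, ENNReal.ofReal_mul (by positivity),
    ENNReal.ofReal_pow hr.le]
  congr 2
  rw [ENNReal.ofReal, Real.toNNReal_of_nonneg Real.pi_nonneg]; rfl

lemma vol_closedBall_pi {n : ℕ} (x : Fin n → ℂ) {r : ℝ} (hr : 0 < r) :
    volume (closedBall x r) = ENNReal.ofReal ((Real.pi * r ^ 2) ^ n) := by
  rw [volume_pi_closedBall _ hr.le]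
  simp only [Complex.volume_closedBall, Finset.prod_const, Finset.card_univ, Fintype.card_fin]
  rw [ENNReal.ofReal_pow (by positivity), mul_comm Real.pi, ENNReal.ofReal_mul (by positivity),
    ENNReal.ofReal_pow hr.le]
  congr 2
  rw [ENNReal.ofReal, Real.toNNReal_of_nonneg Real.pi_nonneg]; rfl

lemma morrey {n : ℕ} {p : ENNReal} (hp : 2 < p) {D : Set (Fin n → ℂ)} {v w : (Fin n → ℂ) → ℂ}
    (hD : IsOpen D) (j : Fin n)
    (hv : ∃ M : ℝ, ∀ (c : Fin n → ℂ) (ε : ℝ), 0 < ε →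
      eLpNorm v p (volume.restrict (D ∩ lineNbhd n j c ε))
        ≤ ENNReal.ofReal (M * (Real.pi * ε ^ 2) ^ (((n : ℝ) - 1) / p.toReal)))
    (hw : LocallyIntegrableOn w D) (hwv : w = v ∨ w = fun _ => 0) {α : ℝ}
    (hα : α ≤ 1 - 2 / p.toReal) :
    ∃ C : ℝ, 0 ≤ C ∧ ∀ (x : Fin n → ℂ) (r : ℝ), 0 < r → r ≤ 1 → ball x r ⊆ D →
      IntegrableOn w (ball x r) ∧ ∫ z in ball x r, ‖w z‖ ≤ C * r ^ (2 * (n:ℝ) - 1 + α) := by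
  obtain ⟨M, hM⟩ := hv
  set e : ℝ := 1 / p.toReal with he
  refine ⟨|M| * Real.pi ^ ((n:ℝ) - e), by positivity, ?_⟩
  intro x r hr hr1 hxr
  have hsub : ball x r ⊆ D ∩ lineNbhd n j x r := by
    refine subset_inter hxr (fun z hz i _ => ?_)
    exact (dist_le_pi_dist z x i).trans_lt hz
  have hwm : AEStronglyMeasurable w (volume.restrict (ball x r)) :=
    hw.aestronglyMeasurable.mono_measure (Measure.restrict_mono hxr le_rfl)
  have hpi : 0 < Real.pi * r ^ 2 := by positivity
  have b1 : eLpNorm w p (volume.restrict (ball x r)) ≤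
      ENNReal.ofReal (|M| * (Real.pi * r ^ 2) ^ (((n : ℝ) - 1) * e)) := by
    rcases hwv with rfl | rfl
    · refine (eLpNorm_mono_measure _ (Measure.restrict_mono hsub le_rfl)).trans ((hM x r hr).trans ?_)
      apply ENNReal.ofReal_le_ofReal
      rw [he, mul_one_div]
      gcongr
      exact le_abs_self M
    · simp
  have b2 := eLpNorm_le_eLpNorm_mul_rpow_measure_univ (p := 1) (q := p)
    (le_of_lt (lt_of_le_of_lt (by norm_num) hp)) hwm
  rw [Measure.restrict_apply_univ, vol_ball_pi x hr] at b2
  have b3 : eLpNorm w 1 (volume.restrict (ball x r)) ≤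
      ENNReal.ofReal (|M| * (Real.pi * r ^ 2) ^ ((n:ℝ) - e)) := by
    refine b2.trans ?_
    refine (mul_le_mul_left b1 _).trans ?_
    rw [ENNReal.ofReal_rpow_of_pos (by positivity), ← ENNReal.ofReal_mul (by positivity), mul_assoc]
    apply le_of_eq
    congr 2
    rw [← Real.rpow_natCast (Real.pi * r ^ 2) n, ← Real.rpow_mul hpi.le, ← Real.rpow_add hpi]
    congr 1
    simp [he]
    ring
  have hint : IntegrableOn w (ball x r) := by
    rw [IntegrableOn, ← memLp_one_iff_integrable]
    exact ⟨hwm, b3.trans_lt ENNReal.ofReal_lt_top⟩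
  refine ⟨hint, ?_⟩
  have b4 : ∫ z in ball x r, ‖w z‖ ≤ |M| * (Real.pi * r ^ 2) ^ ((n:ℝ) - e) := by
    rw [integral_norm_eq_lintegral_enorm hwm, ← eLpNorm_one_eq_lintegral_enorm]
    exact ENNReal.toReal_le_of_le_ofReal (by positivity) b3
  refine b4.trans ?_
  rw [Real.mul_rpow Real.pi_nonneg (by positivity), mul_assoc]
  gcongr
  rw [← Real.rpow_natCast, ← Real.rpow_mul hr.le]
  apply Real.rpow_le_rpow_of_exponent_ge hr hr1
  have : 2 / p.toReal = 2 * e := by rw [he]; ring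
  rw [this] at hα
  push_cast
  linarith

lemma int_bound {n : ℕ} {D : Set (Fin n → ℂ)} (hD : IsOpen D) {w g : (Fin n → ℂ) → ℂ} {K R : ℝ}
    {x : Fin n → ℂ} (hx : ball x R ⊆ D) (hw : IntegrableOn w (ball x R)) (hK : ∀ z, ‖g z‖ ≤ K)
    (h0 : ∀ z, z ∉ ball x R → g z = 0) :
    ‖∫ z in D, w z * g z‖ ≤ (∫ z in ball x R, ‖w z‖) * K := by
  rw [setIntegral_eq_of_subset_of_forall_sdiff_eq_zero hD.measurableSet hx
    (fun z hz => by rw [h0 z hz.2, mul_zero]), ← integral_mul_const]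
  apply norm_integral_le_of_norm_le (hw.norm.mul_const K)
  filter_upwards with z
  rw [norm_mul]
  gcongr
  exact hK z

def FK (n : ℕ) (D : Set (Fin n → ℂ)) (u ρ : (Fin n → ℂ) → ℂ) (l : ℝ) (x : Fin n → ℂ) : ℂ :=
  ∫ z in D, u z * ((l:ℂ) ^ (2 * n) * ρ (l • (z - x)))

lemma scaled_zero {n : ℕ} {f : (Fin n → ℂ) → ℂ} (hf : ∀ z, 1 < ‖z‖ → f z = 0) {l : ℝ} (hl : 0 < l)
    {x z : Fin n → ℂ} (hz : z ∉ closedBall x (1 / l)) : f (l • (z - x)) = 0 := by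
  apply hf
  rw [mem_closedBall, not_le, dist_eq_norm, div_lt_iff₀ hl] at hz
  rw [norm_smul, Real.norm_of_nonneg hl.le]
  linarith

lemma scaled_test {n : ℕ} {D : Set (Fin n → ℂ)} {f : (Fin n → ℂ) → ℂ} (hs : ContDiff ℝ ∞ f)
    (hf : ∀ z, 1 < ‖z‖ → f z = 0) {l : ℝ} (hl : 0 < l) (c : ℂ) {x : Fin n → ℂ}
    (hx : closedBall x (1 / l) ⊆ D) : IsTestC n D (fun z => c * f (l • (z - x))) := by
  have hsup : tsupport (fun z => c * f (l • (z - x))) ⊆ closedBall x (1 / l) := by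
    apply closure_minimal _ isClosed_closedBall
    intro z hz
    by_contra hc
    exact hz (by simp [scaled_zero hf hl hc])
  refine ⟨contDiff_const.mul (hs.comp (by fun_prop)), ?_, hsup.trans hx⟩
  exact (isCompact_closedBall x (1/l)).of_isClosed_subset (isClosed_tsupport _) hsup

lemma FK_step {n : ℕ} {D : Set (Fin n → ℂ)} (hD : IsOpen D) {u ρ : (Fin n → ℂ) → ℂ}
    {w Ψ : Fin n → (Fin n → ℂ) → ℂ} (hu : LocallyIntegrableOn u D) 
    (heq : ∀ j, ∀ φ : (Fin n → ℂ) → ℂ, IsTestC n D φ →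
      ∫ z in D, u z * dbarCoord n φ j z = - ∫ z in D, w j z * φ z)
    (hρ : ContDiff ℝ ∞ ρ) (hΨ : ∀ j, ContDiff ℝ ∞ (Ψ j)) (hρ0 : ∀ z, 1 < ‖z‖ → ρ z = 0)
    (hΨ0 : ∀ j z, 1 < ‖z‖ → Ψ j z = 0)
    (hid : ∀ z, 2 ^ (2 * n) * ρ ((2:ℝ) • z) - ρ z = ∑ j, dbarCoord n (Ψ j) j z)
    {l : ℝ} (hl : 0 < l) {x : Fin n → ℂ} (hx : closedBall x (1 / l) ⊆ D) :
    FK n D u ρ (2 * l) x - FK n D u ρ l x =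
      - ∑ j, ∫ z in D, w j z * (((l:ℂ) ^ (2 * n) / l) * Ψ j (l • (z - x))) := by
  have ht : ∀ j, IsTestC n D (fun z => ((l:ℂ) ^ (2 * n) / l) * Ψ j (l • (z - x))) :=
    fun j => scaled_test (hΨ j) (hΨ0 j) hl _ hx
  have hl' : (l:ℂ) ≠ 0 := by exact_mod_cast hl.ne'
  rw [← Finset.sum_neg_distrib]
  simp only [← heq _ _ (ht _)]
  rw [← integral_finsetSum _ (fun j _ => integrableOn_dbar hD hu (ht j) j)]
  unfold FK
  have hi : ∀ l' : ℝ, l ≤ l' →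
      IntegrableOn (fun z => u z * ((l':ℂ) ^ (2 * n) * ρ (l' • (z - x)))) D := by
    intro l' hl'
    have hl0 : 0 < l' := hl.trans_le hl'
    have hc : Continuous (fun z : Fin n → ℂ => (l':ℂ) ^ (2 * n) * ρ (l' • (z - x))) := by
      have := hρ.continuous
      fun_prop
    refine integrableOn_mul hD hu hc (isCompact_closedBall x (1/l)) hx (fun z hz => ?_)
    rw [scaled_zero hρ0 hl0, mul_zero]
    intro h
    apply hz
    exact closedBall_subset_closedBall (one_div_le_one_div_of_le hl hl') h
  rw [← integral_sub (hi (2*l) (by linarith)) (hi l le_rfl)]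
  congr 1
  ext z
  simp only [dbar_scale (hΨ _)]
  rw [← Finset.mul_sum, ← Finset.mul_sum, ← hid]
  rw [smul_smul]
  push_cast
  rw [mul_pow]
  field_simp

lemma FK_tendsto {n : ℕ} {D : Set (Fin n → ℂ)} (hD : IsOpen D) {u ρ : (Fin n → ℂ) → ℂ}
    (hu : LocallyIntegrableOn u D) (hρ : ContDiff ℝ ∞ ρ) (hρ0 : ∀ z, 1 < ‖z‖ → ρ z = 0)
    (hρ1 : ∫ z, ρ z = 1) :
    ∀ᵐ x ∂(volume.restrict D),
      Filter.Tendsto (fun k : ℕ => FK n D u ρ (2 ^ k) x) Filter.atTop (nhds (u x)) := by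
  obtain ⟨A, hA⟩ := (hasCompactSupport_of_ball hρ0).exists_bound_of_continuous hρ.continuous
  rw [ae_restrict_iff' hD.measurableSet, ae_iff]
  apply measure_null_of_locally_null
  intro y hy
  simp only [mem_ofPred_eq, Classical.not_imp] at hy
  obtain ⟨R, hR, hRD⟩ := Metric.nhds_basis_closedBall.mem_iff.1 (hD.mem_nhds hy.1)
  set f : (Fin n → ℂ) → ℂ := (closedBall y R).indicator u with hf
  have hfi : Integrable f := by
    rw [hf, integrable_indicator_iff measurableSet_closedBall]
    exact hu.integrableOn_compact_subset hRD (isCompact_closedBall y R)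
  have hae := IsUnifLocDoublingMeasure.ae_tendsto_average_norm_sub (volume : Measure (Fin n → ℂ))
    hfi.locallyIntegrable 1
  refine ⟨ball y R ∩ {x | ¬ (x ∈ D → Filter.Tendsto (fun k : ℕ => FK n D u ρ (2 ^ k) x)
    Filter.atTop (nhds (u x)))}, ?_, ?_⟩
  · exact Filter.inter_mem (mem_nhdsWithin_of_mem_nhds (ball_mem_nhds y hR)) self_mem_nhdsWithin
  have : ∀ᵐ x, x ∈ ball y R → Filter.Tendsto (fun k : ℕ => FK n D u ρ (2 ^ k) x)
    Filter.atTop (nhds (u x)) := by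
    filter_upwards [hae] with x hx hxy
    have hδ : Filter.Tendsto (fun k : ℕ => 1 / (2:ℝ) ^ k) Filter.atTop (nhdsWithin 0 (Ioi 0)) := by
      rw [tendsto_nhdsWithin_iff]
      refine ⟨?_, Filter.Eventually.of_forall fun k => by simp⟩
      exact (tendsto_inv_atTop_zero.comp
        (tendsto_pow_atTop_atTop_of_one_lt (one_lt_two (α := ℝ)))).congr (fun k => by simp)
    have hav := hx (fun _ => x) _ hδ (Filter.Eventually.of_forall fun k => by
      apply mem_closedBall_self; positivity)
    rw [tendsto_iff_norm_sub_tendsto_zero]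
    have hav2 := hav.const_mul (A * Real.pi ^ n)
    rw [mul_zero] at hav2
    refine squeeze_zero' (Filter.Eventually.of_forall fun k => norm_nonneg _) ?_ hav2
    obtain ⟨r, hr, hrR⟩ := Metric.isOpen_iff.1 isOpen_ball x hxy
    filter_upwards [hδ.eventually (mem_nhdsWithin_of_mem_nhds (Iio_mem_nhds hr))] with k hk
    set l : ℝ := 2 ^ k with hl
    have hl0 : 0 < l := by positivity
    have hsub : closedBall x (1 / l) ⊆ ball y R := (closedBall_subset_ball hk).trans hrR
    have hc : Continuous (fun z : Fin n → ℂ => (l:ℂ) ^ (2 * n) * ρ (l • (z - x))) := by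
      have := hρ.continuous
      fun_prop
    have e0 : ∀ z, z ∉ closedBall x (1/l) → (l:ℂ) ^ (2 * n) * ρ (l • (z - x)) = 0 := by
      intro z hz; rw [scaled_zero hρ0 hl0 hz, mul_zero]
    have e1 : FK n D u ρ l x = ∫ z, f z * ((l:ℂ) ^ (2 * n) * ρ (l • (z - x))) := by
      unfold FK
      rw [← integral_indicator hD.measurableSet]
      congr 1
      ext z
      by_cases hz : z ∈ closedBall x (1/l)
      · have h1 : z ∈ closedBall y R := ball_subset_closedBall (hsub hz)
        simp [hf, h1, hRD h1]
      · by_cases hzD : z ∈ D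
        · simp [hzD, scaled_zero hρ0 hl0 hz]
        · simp [hzD, scaled_zero hρ0 hl0 hz]
    have e2 : ∫ z, (l:ℂ) ^ (2 * n) * ρ (l • (z - x)) = 1 := by
      rw [integral_const_mul, integral_sub_right_eq_self (fun z => ρ (l • z)) x,
        Measure.integral_comp_smul, hρ1]
      simp only [Module.finrank_pi_fintype, Complex.finrank_real_complex, Finset.sum_const, Finset.card_univ, Fintype.card_fin]
      rw [abs_of_pos (by positivity)]
      have hl' : (l:ℂ) ≠ 0 := by exact_mod_cast hl0.ne'
      simp
      rw [mul_comm n 2]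
      field_simp
    have e3 : u x = f x := by simp [hf, ball_subset_closedBall hxy]
    have i1 : Integrable (fun z => f z * ((l:ℂ) ^ (2 * n) * ρ (l • (z - x)))) := by
      have := integrableOn_mul isOpen_univ (hfi.locallyIntegrable.locallyIntegrableOn univ) hc
        (isCompact_closedBall x (1/l)) (subset_univ _) e0
      simpa using this
    have i2 : Integrable (fun z => (l:ℂ) ^ (2 * n) * ρ (l • (z - x))) :=
      hc.integrable_of_hasCompactSupport
        (HasCompactSupport.intro (isCompact_closedBall x (1/l)) e0)
    have e4 : FK n D u ρ l x - u x = ∫ z, (f z - f x) * ((l:ℂ) ^ (2 * n) * ρ (l • (z - x))) := by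
      simp only [sub_mul]
      rw [integral_sub i1 (i2.const_mul _), integral_const_mul, e2, mul_one, e1, e3]
    have i3 : IntegrableOn (fun z => f z - f x) (closedBall x (1/l)) :=
      hfi.integrableOn.sub (integrableOn_const (by simp [measure_closedBall_lt_top.ne]))
    have e5 : ‖FK n D u ρ l x - u x‖ ≤ (∫ z in closedBall x (1/l), ‖f z - f x‖) * (l ^ (2 * n) * A) := by
      rw [e4, ← setIntegral_eq_integral_of_forall_compl_eq_zero (s := closedBall x (1/l))
        (fun z hz => by rw [e0 z hz, mul_zero]), ← integral_mul_const]
      apply norm_integral_le_of_norm_le (i3.norm.mul_const _)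
      filter_upwards with z
      rw [norm_mul, norm_mul, norm_pow, Complex.norm_real, Real.norm_of_nonneg hl0.le]
      gcongr
      exact hA _
    refine e5.trans (le_of_eq ?_)
    have hvol : volume.real (closedBall x (1/l)) = (Real.pi * (1/l) ^ 2) ^ n := by
      rw [Measure.real, vol_closedBall_pi x (by positivity), ENNReal.toReal_ofReal (by positivity)]
    rw [setAverage_eq, hvol, smul_eq_mul, mul_pow]
    have := Real.pi_pos
    clear_value l
    clear hl hk
    generalize (∫ z in closedBall x (1/l), ‖f z - f x‖) = I0
    rw [one_div, inv_pow, inv_pow, ← pow_mul]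
    field_simp
  refine measure_mono_null ?_ this
  rintro x ⟨h1, h2⟩ h3
  exact h2 fun _ => h3 h1

lemma local_holder {n : ℕ} {D : Set (Fin n → ℂ)} (hD : IsOpen D) {u ρ : (Fin n → ℂ) → ℂ}
    {w Ψ : Fin n → (Fin n → ℂ) → ℂ} (hu : LocallyIntegrableOn u D) 
    (heq : ∀ j, ∀ φ : (Fin n → ℂ) → ℂ, IsTestC n D φ →
      ∫ z in D, u z * dbarCoord n φ j z = - ∫ z in D, w j z * φ z)
    (hρ : ContDiff ℝ ∞ ρ) (hΨ : ∀ j, ContDiff ℝ ∞ (Ψ j)) (hρ0 : ∀ z, 1 < ‖z‖ → ρ z = 0)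
    (hΨ0 : ∀ j z, 1 < ‖z‖ → Ψ j z = 0)
    (hid : ∀ z, 2 ^ (2 * n) * ρ ((2:ℝ) • z) - ρ z = ∑ j, dbarCoord n (Ψ j) j z)
    {α : ℝ} (h0 : 0 < α) (h1 : α < 1)
    (hw : ∀ j, ∃ C : ℝ, 0 ≤ C ∧ ∀ (x : Fin n → ℂ) (r : ℝ), 0 < r → r ≤ 1 → ball x r ⊆ D →
      IntegrableOn (w j) (ball x r) ∧ ∫ z in ball x r, ‖w j z‖ ≤ C * r ^ (2 * (n:ℝ) - 1 + α)) :
    HolderLocOnC n α (fun x => Filter.limUnder Filter.atTop (fun k : ℕ => FK n D u ρ (2 ^ k) x)) D := by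
  choose C hC0 hC using hw
  have hbd : ∀ j, ∃ A, ∀ z, ‖Ψ j z‖ ≤ A := fun j =>
    (hasCompactSupport_of_ball (hΨ0 j)).exists_bound_of_continuous (hΨ j).continuous
  choose A hA using hbd
  have hA0 : ∀ j, 0 ≤ A j := fun j => (norm_nonneg _).trans (hA j 0)
  have hlip : ∀ j, ∃ B, LipschitzWith B (Ψ j) := fun j =>
    ContDiff.lipschitzWith_of_hasCompactSupport (hasCompactSupport_of_ball (hΨ0 j)) (hΨ j) (by simp)
  choose B hB using hlip
  obtain ⟨Lρ, hLρ⟩ := ContDiff.lipschitzWith_of_hasCompactSupport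
    (hasCompactSupport_of_ball hρ0) hρ (by simp)
  intro x0 hx0
  obtain ⟨R, hR, hRD⟩ := Metric.isOpen_iff.1 hD x0 hx0
  obtain ⟨k0, hk0⟩ : ∃ k0 : ℕ, 1 / (2:ℝ) ^ k0 < min (R / 5) (1 / 3) := by
    obtain ⟨k, hk⟩ := exists_pow_lt_of_lt_one (y := (1/2 : ℝ)) (lt_min (by linarith : 0 < R/5)
      (by norm_num : (0:ℝ) < 1/3)) (by norm_num)
    exact ⟨k, by simpa using hk⟩
  set l0 : ℝ := 2 ^ k0 with hl0
  have hl0p : 0 < l0 := by positivity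
  set δ : ℝ := 1 / l0 with hδ
  have hδp : 0 < δ := by positivity
  have hδ1 : 5 * δ < R := by linarith [hk0.trans_le (min_le_left _ _)]
  have hδ2 : 3 * δ ≤ 1 := by linarith [hk0.trans_le (min_le_right _ _)]
  set E : ℝ := 2 * (n:ℝ) - 1 + α with hE
  set q : ℝ := (2:ℝ) ^ (-α) with hq
  have hq0 : 0 < q := by positivity
  have hq1 : q < 1 := Real.rpow_lt_one_of_one_lt_of_neg (by norm_num) (by linarith)
  have hlk : ∀ k : ℕ, (2:ℝ) ^ (k0 + k) = l0 * 2 ^ k := fun k => by rw [hl0, pow_add]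
  have hlkp : ∀ k : ℕ, 0 < l0 * 2 ^ k := fun k => by positivity
  have hlk1 : ∀ k : ℕ, 3 / (l0 * 2 ^ k) ≤ 3 * δ := fun k => by
    rw [hδ, mul_one_div]
    gcongr
    exact le_mul_of_one_le_right hl0p.le (one_le_pow₀ (by norm_num))
  have hpow : ∀ k : ℕ, (l0 * 2 ^ k) ^ (2 * n) / (l0 * 2 ^ k) * (3 / (l0 * 2 ^ k)) ^ E =
      3 ^ E * l0 ^ (-α) * q ^ k := by
    intro k
    have hp := hlkp k
    have e1 : q ^ k = ((2:ℝ) ^ k) ^ (-α) := by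
      rw [hq, ← Real.rpow_natCast, ← Real.rpow_natCast, ← Real.rpow_mul (by norm_num),
        ← Real.rpow_mul (by norm_num), mul_comm]
    rw [e1, mul_assoc, ← Real.mul_rpow hl0p.le (by positivity)]
    rw [Real.div_rpow (by norm_num) hp.le]
    have e2 : (l0 * 2 ^ k) ^ (2 * n) / (l0 * 2 ^ k) = (l0 * 2 ^ k) ^ (2 * (n:ℝ) - 1) := by
      rw [Real.rpow_sub_one hp.ne', ← Real.rpow_natCast]
      push_cast; rfl
    rw [e2, mul_div_assoc', mul_comm, mul_div_assoc, ← Real.rpow_sub hp]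
    congr 2
    rw [hE]; ring
  -- geometry
  have hball : ∀ x ∈ ball x0 (δ/2), ∀ k : ℕ, ball x (3 / (l0 * 2 ^ k)) ⊆ D := by
    intro x hx k z hz
    apply hRD
    have a := mem_ball.1 hx
    have b := mem_ball.1 hz
    have c := hlk1 k
    have d := dist_triangle z x x0
    rw [mem_ball]; linarith
  have hcball : ∀ x : Fin n → ℂ, ∀ k : ℕ,
      closedBall x (1 / (l0 * 2 ^ k)) ⊆ ball x (3 / (l0 * 2 ^ k)) := by
    intro x k
    apply closedBall_subset_ball
    have := hlkp k
    gcongr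
    norm_num
  have hstep : ∀ x ∈ ball x0 (δ/2), ∀ k : ℕ,
      FK n D u ρ (2 ^ (k0 + (k + 1))) x - FK n D u ρ (2 ^ (k0 + k)) x =
      - ∑ j, ∫ z in D, w j z * ((((l0 * 2 ^ k : ℝ):ℂ) ^ (2 * n) / ((l0 * 2 ^ k : ℝ):ℂ)) *
        Ψ j ((l0 * 2 ^ k) • (z - x))) := by
    intro x hx k
    rw [show (2:ℝ) ^ (k0 + (k + 1)) = 2 * (l0 * 2 ^ k) by rw [hl0]; ring, hlk]
    exact FK_step hD hu heq hρ hΨ hρ0 hΨ0 hid (hlkp k) ((hcball x k).trans (hball x hx k))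
  have hnc : ∀ k : ℕ, ‖((l0 * 2 ^ k : ℝ):ℂ) ^ (2 * n) / ((l0 * 2 ^ k : ℝ):ℂ)‖ =
      (l0 * 2 ^ k) ^ (2 * n) / (l0 * 2 ^ k) := by
    intro k
    rw [norm_div, norm_pow, Complex.norm_real, Real.norm_of_nonneg (hlkp k).le]
  -- bound (a)
  set A' : ℝ := ∑ j, C j * A j * (3 ^ E * l0 ^ (-α)) with hA'
  have ha : ∀ x ∈ ball x0 (δ/2), ∀ k : ℕ,
      ‖FK n D u ρ (2 ^ (k0 + (k + 1))) x - FK n D u ρ (2 ^ (k0 + k)) x‖ ≤ A' * q ^ k := by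
    intro x hx k
    rw [hstep x hx k, norm_neg, hA', Finset.sum_mul]
    refine (norm_sum_le _ _).trans (Finset.sum_le_sum fun j _ => ?_)
    have hp := hlkp k
    obtain ⟨m1, m2⟩ := hC j x (3 / (l0 * 2 ^ k)) (by positivity) ((hlk1 k).trans hδ2) (hball x hx k)
    refine (int_bound hD (hball x hx k) m1 (K := (l0 * 2 ^ k) ^ (2 * n) / (l0 * 2 ^ k) * A j)
      (fun z => ?_) (fun z hz => ?_)).trans ?_
    · rw [norm_mul, hnc]
      gcongr
      exact hA j _
    · rw [scaled_zero (hΨ0 j) hp (fun h => hz (hcball x k h)), mul_zero]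
    · have hAj := hA0 j
      calc _ ≤ (C j * (3 / (l0 * 2 ^ k)) ^ E) * ((l0 * 2 ^ k) ^ (2 * n) / (l0 * 2 ^ k) * A j) := by
            gcongr
        _ = C j * A j * ((l0 * 2 ^ k) ^ (2 * n) / (l0 * 2 ^ k) * (3 / (l0 * 2 ^ k)) ^ E) := by ring
        _ = _ := by rw [hpow]; ring
  set B' : ℝ := ∑ j, C j * B j * (3 ^ E * l0 ^ (-α)) with hB'
  have hb : ∀ x ∈ ball x0 (δ/2), ∀ y ∈ ball x0 (δ/2), ∀ k : ℕ, 2 ^ k * (l0 * dist x y) ≤ 1 →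
      ‖(FK n D u ρ (2 ^ (k0 + (k + 1))) x - FK n D u ρ (2 ^ (k0 + k)) x) -
        (FK n D u ρ (2 ^ (k0 + (k + 1))) y - FK n D u ρ (2 ^ (k0 + k)) y)‖
        ≤ B' * (2 * q) ^ k * (l0 * dist x y) := by
    intro x hx y hy k hk
    have hp := hlkp k
    have hint : ∀ j, ∀ x ∈ ball x0 (δ/2), IntegrableOn (fun z => w j z *
        ((((l0 * 2 ^ k : ℝ):ℂ) ^ (2 * n) / ((l0 * 2 ^ k : ℝ):ℂ)) *
        Ψ j ((l0 * 2 ^ k) • (z - x)))) D := by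
      intro j x hx
      obtain ⟨m1, m2⟩ := hC j x (3 / (l0 * 2 ^ k)) (by positivity) ((hlk1 k).trans hδ2) (hball x hx k)
      have hc : Continuous (fun z => (((l0 * 2 ^ k : ℝ):ℂ) ^ (2 * n) / ((l0 * 2 ^ k : ℝ):ℂ)) *
        Ψ j ((l0 * 2 ^ k) • (z - x))) := by
        have := (hΨ j).continuous
        fun_prop
      have i2 := (m1.mono_set (hcball x k)).mul_continuousOn hc.continuousOn
        (isCompact_closedBall x _)
      refine Integrable.integrableOn ?_
      rw [← integrableOn_iff_integrable_of_support_subset (s := closedBall x (1 / (l0 * 2 ^ k)))]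
      · exact i2
      · intro z hz
        by_contra hc
        exact hz (by simp only [scaled_zero (hΨ0 j) hp hc, mul_zero])
    rw [hstep x hx k, hstep y hy k, neg_sub_neg, norm_sub_rev, ← Finset.sum_sub_distrib, hB',
      Finset.sum_mul, Finset.sum_mul]
    refine (norm_sum_le _ _).trans (Finset.sum_le_sum fun j _ => ?_)
    rw [← integral_sub (hint j x hx) (hint j y hy)]
    simp only [← mul_sub]
    obtain ⟨m1, m2⟩ := hC j x (3 / (l0 * 2 ^ k)) (by positivity) ((hlk1 k).trans hδ2) (hball x hx k)
    refine (int_bound hD (hball x hx k) m1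
      (K := (l0 * 2 ^ k) ^ (2 * n) / (l0 * 2 ^ k) * (B j * ((l0 * 2 ^ k) * dist x y)))
      (fun z => ?_) (fun z hz => ?_)).trans ?_
    · rw [norm_mul, hnc]
      gcongr
      rw [← dist_eq_norm]
      refine ((hB j).dist_le_mul _ _).trans (le_of_eq ?_)
      congr 1
      rw [dist_smul₀, dist_sub_left, Real.norm_of_nonneg hp.le]
    · have hz1 : z ∉ closedBall x (1 / (l0 * 2 ^ k)) := fun h => hz (hcball x k h)
      have hz2 : z ∉ closedBall y (1 / (l0 * 2 ^ k)) := by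
        intro h
        apply hz
        rw [mem_closedBall] at h
        rw [mem_ball]
        have t := dist_triangle z y x
        rw [dist_comm y x] at t
        have t2 : dist x y ≤ 1 / (l0 * 2 ^ k) := by
          rw [le_div_iff₀ hp]; linarith
        have t3 : 3 / (l0 * 2 ^ k) = 3 * (1 / (l0 * 2 ^ k)) := by ring
        have t4 : 0 < 1 / (l0 * 2 ^ k) := by positivity
        rw [t3]; linarith
      rw [scaled_zero (hΨ0 j) hp hz1, scaled_zero (hΨ0 j) hp hz2, sub_zero, mul_zero]
    · calc _ ≤ (C j * (3 / (l0 * 2 ^ k)) ^ E) *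
              ((l0 * 2 ^ k) ^ (2 * n) / (l0 * 2 ^ k) * (B j * ((l0 * 2 ^ k) * dist x y))) := by
            gcongr
        _ = C j * B j * ((l0 * 2 ^ k) ^ (2 * n) / (l0 * 2 ^ k) * (3 / (l0 * 2 ^ k)) ^ E) *
              ((l0 * 2 ^ k) * dist x y) := by ring
        _ = _ := by rw [hpow, mul_pow]; ring
  -- bound (c)
  have hub : IntegrableOn u (ball x0 (4 * δ)) :=
    (hu.integrableOn_compact_subset ((closedBall_subset_ball (by linarith)).trans hRD)
      (isCompact_closedBall x0 (4 * δ))).mono_set ball_subset_closedBall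
  set L' : ℝ := (∫ z in ball x0 (4 * δ), ‖u z‖) * (l0 ^ (2 * n) * Lρ) with hL'
  have hL0 : 0 ≤ L' := mul_nonneg (integral_nonneg fun z => norm_nonneg _) (by positivity)
  have hc : ∀ x ∈ ball x0 (δ/2), ∀ y ∈ ball x0 (δ/2),
      ‖FK n D u ρ (2 ^ (k0 + 0)) x - FK n D u ρ (2 ^ (k0 + 0)) y‖ ≤ L' * (l0 * dist x y) := by
    intro x hx y hy
    rw [add_zero, ← hl0]
    have hsub : ∀ x ∈ ball x0 (δ/2), closedBall x (1 / l0) ⊆ ball x0 (4 * δ) := by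
      intro x hx z hz
      have a := mem_ball.1 hx
      have b := mem_closedBall.1 hz
      have d := dist_triangle z x x0
      rw [mem_ball]; linarith
    have hbD : ball x0 (4 * δ) ⊆ D := (ball_subset_ball (by linarith)).trans hRD
    have hi : ∀ x ∈ ball x0 (δ/2),
        IntegrableOn (fun z => u z * ((l0:ℂ) ^ (2 * n) * ρ (l0 • (z - x)))) D := by
      intro x hx
      have hc : Continuous (fun z : Fin n → ℂ => (l0:ℂ) ^ (2 * n) * ρ (l0 • (z - x))) := by
        have := hρ.continuous
        fun_prop
      exact integrableOn_mul hD hu hc (isCompact_closedBall x (1/l0)) ((hsub x hx).trans hbD)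
        (fun z hz => by rw [scaled_zero hρ0 hl0p hz, mul_zero])
    unfold FK
    rw [← integral_sub (hi x hx) (hi y hy)]
    simp only [← mul_sub]
    refine (int_bound hD hbD hub
      (K := l0 ^ (2 * n) * (Lρ * (l0 * dist x y))) (fun z => ?_) (fun z hz => ?_)).trans
      (le_of_eq (by rw [hL']; ring))
    · rw [norm_mul, norm_pow, Complex.norm_real, Real.norm_of_nonneg hl0p.le]
      gcongr
      rw [← dist_eq_norm]
      refine (hLρ.dist_le_mul _ _).trans (le_of_eq ?_)
      congr 1
      rw [dist_smul₀, dist_sub_left, Real.norm_of_nonneg hl0p.le]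
    · rw [scaled_zero hρ0 hl0p (fun h => hz (hsub x hx h)),
        scaled_zero hρ0 hl0p (fun h => hz (hsub y hy h)), sub_zero, mul_zero]
  have hA'0 : 0 ≤ A' := Finset.sum_nonneg fun j _ => by
    have := hC0 j; have := hA0 j; positivity
  have hB'0 : 0 ≤ B' := Finset.sum_nonneg fun j _ => by
    have := hC0 j; positivity
  have hlim : ∀ x ∈ ball x0 (δ/2), Filter.Tendsto (fun k => FK n D u ρ (2 ^ (k0 + k)) x)
      Filter.atTop (nhds (Filter.limUnder Filter.atTop (fun k : ℕ => FK n D u ρ (2 ^ k) x))) := by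
    intro x hx
    have hcs : CauchySeq (fun k => FK n D u ρ (2 ^ (k0 + k)) x) :=
      cauchySeq_of_le_geometric q A' hq1 (fun k => by
        rw [dist_comm, dist_eq_norm]; exact ha x hx k)
    obtain ⟨a, hlim⟩ := cauchySeq_tendsto_of_complete hcs
    have h2 : Filter.Tendsto (fun k : ℕ => FK n D u ρ (2 ^ k) x) Filter.atTop (nhds a) := by
      rw [← Filter.tendsto_add_atTop_iff_nat k0]
      simpa only [add_comm] using hlim
    rw [h2.limUnder_eq]
    exact hlim
  refine ⟨ball x0 (δ/2), isOpen_ball, mem_ball_self (by positivity),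
    (L' + 2 * B' / (2 * q - 1) + 4 * A' / (1 - q)) * l0 ^ α, ?_⟩
  rintro x ⟨hx, -⟩ y ⟨hy, -⟩
  rcases eq_or_ne x y with rfl | hxy
  · simp [Real.zero_rpow h0.ne']
  have hdp : 0 < dist x y := dist_pos.2 hxy
  have hdd : l0 * dist x y ≤ 1 := by
    have a := mem_ball.1 hx
    have b := mem_ball.1 hy
    have c := dist_triangle_right x y x0
    have : dist x y ≤ δ := by linarith
    rw [hδ, le_div_iff₀ hl0p] at this
    linarith
  have := seq_holder h0 h1 hA'0 hB'0 hL0 (mul_pos hl0p hdp) hdd hq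
    (a := fun k => FK n D u ρ (2 ^ (k0 + k)) x) (b := fun k => FK n D u ρ (2 ^ (k0 + k)) y)
    (ha x hx) (ha y hy) (hb x hx y hy) (hc x hx y hy) (hlim x hx) (hlim y hy)
  rw [Real.mul_rpow hl0p.le dist_nonneg, ← mul_assoc] at this
  exact this

/-- **Remark 3 d).**  Let `2 < p ≤ ∞`, `D ⊆ ℂⁿ` open, `u ∈ L¹_loc(D)` with
`∂̄u = v₁ dz̄₁ + … + v_n dz̄_n` in the distribution sense.  If for each `j` there is
`M` with `‖v_j‖_{L^p(D ∩ L_{j,ε})} ≤ M(πε²)^{(n−1)/p}` for all `z_j`-lines `L_j` and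
all `ε > 0`, then `u` is locally of class `C^α` on `D`, with `α = 1 − 2/p` when
`2 < p < ∞` and any `α < 1` when `p = ∞`. -/
theorem remark_d (n : ℕ) (p : ENNReal) (hp : 2 < p)
    (D : Set (Fin n → ℂ)) (hD : IsOpen D)
    (u : (Fin n → ℂ) → ℂ) (hu : LocallyIntegrableOn u D)
    (v : Fin n → (Fin n → ℂ) → ℂ)
    (heq : ∀ j : Fin n, ∀ φ : (Fin n → ℂ) → ℂ, IsTestC n D φ →
      ∫ z in D, u z * dbarCoord n φ j z = - ∫ z in D, v j z * φ z)
    (hv : ∀ j : Fin n, ∃ M : ℝ, ∀ (c : Fin n → ℂ) (ε : ℝ), 0 < ε →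
      eLpNorm (v j) p (volume.restrict (D ∩ lineNbhd n j c ε))
        ≤ ENNReal.ofReal (M * (Real.pi * ε ^ 2) ^ (((n : ℝ) - 1) / p.toReal))) :
    ∃ u2 : (Fin n → ℂ) → ℂ, (u =ᵐ[volume.restrict D] u2) ∧
      ((p ≠ ⊤ → HolderLocOnC n (1 - 2 / p.toReal) u2 D) ∧
       (p = ⊤ → ∀ α : ℝ, 0 < α → α < 1 → HolderLocOnC n α u2 D)) := by
  rcases eq_or_ne n 0 with rfl | hn
  · have key : ∀ α : ℝ, HolderLocOnC 0 α u D := by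
      intro α x _
      refine ⟨univ, isOpen_univ, mem_univ _, 0, fun a _ b _ => ?_⟩
      rw [Subsingleton.elim a b]; simp
    exact ⟨u, Filter.EventuallyEq.rfl, fun _ => key _, fun _ α _ _ => key α⟩
  obtain ⟨ρ, Ψ, hρ, hΨ, hρ0, hΨ0, hρ1, hid⟩ := exists_kernel hn
  choose w hw1 hw2 hw3 using fun j => exists_w hD hu (v j) j (heq j)
  have main : ∀ α : ℝ, 0 < α → α < 1 → α ≤ 1 - 2 / p.toReal →
      HolderLocOnC n α (fun x => Filter.limUnder Filter.atTop (fun k : ℕ => FK n D u ρ (2 ^ k) x)) D :=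
    fun α h0 h1 h2 => local_holder hD hu hw3 hρ hΨ hρ0 hΨ0 hid h0 h1
      (fun j => morrey hp hD j (hv j) (hw1 j) (hw2 j) h2)
  refine ⟨fun x => Filter.limUnder Filter.atTop (fun k : ℕ => FK n D u ρ (2 ^ k) x), ?_, ?_, ?_⟩
  · filter_upwards [FK_tendsto hD hu hρ hρ0 hρ1] with x hx
    exact hx.limUnder_eq.symm
  · intro hpt
    have h2 : 2 < p.toReal := by
      have := (ENNReal.toReal_lt_toReal (by simp) hpt).2 hp
      simpa using this
    refine main _ ?_ ?_ le_rfl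
    · rw [sub_pos, div_lt_one (by linarith)]; exact h2
    · have : 0 < 2 / p.toReal := by positivity
      linarith
  · rintro rfl α h0 h1
    exact main α h0 h1 (by simpa using h1.le)

end
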